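/- On ℝ^(2n) with coordinates (q^i, p_i), let Π be a smooth one-form with components (Π_i, Π^i) (i.e., Π = Π_i dq^i + Π^i dp_i) and H a smooth function. Define the density f(Π) = Σ_i (∂Π^i/∂q^i − ∂Π_i/∂p_i) = div ♯^s(Π). Then f intertwines the momentum-Vlasov and Vlasov flows: f(L_{X^s_H} Π) = {f(Π), H}^s, where L_{X^s_H} Π is the Lie derivative of the one-form Π along the symplectic Hamiltonian vector field X^s_H. Consequently, if Π solves the momentum-Vlasov equation ∂Π/∂s = −L_{X^s_H} Π, then f(Π) solves the Vlasov equation ∂f/∂s = {H, f}^s. -/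

import Mathlib

noncomputable section

/-- The symplectic phase space `ℝ^(2n)` with coordinates `(q, p)`. -/
abbrev Ms (n : ℕ) : Type := (Fin n → ℝ) × (Fin n → ℝ)

/-- Coordinate direction `∂/∂qⁱ`. -/
def eQ (n : ℕ) (i : Fin n) : Ms n := (Pi.single i 1, 0)

/-- Coordinate direction `∂/∂pᵢ`. -/
def eP (n : ℕ) (i : Fin n) : Ms n := (0, Pi.single i 1)

/-- Partial derivative of `F` in the direction `v`. -/
def pd {n : ℕ} (F : Ms n → ℝ) (v : Ms n) (x : Ms n) : ℝ := fderiv ℝ F x v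

/-- The canonical Poisson bracket
`{F,H}^s = Σᵢ (∂F/∂qⁱ ∂H/∂pᵢ − ∂F/∂pᵢ ∂H/∂qⁱ)`. -/
def sBracket {n : ℕ} (F H : Ms n → ℝ) : Ms n → ℝ :=
  fun x => ∑ i, (pd F (eQ n i) x * pd H (eP n i) x - pd F (eP n i) x * pd H (eQ n i) x)

/-- The symplectic Hamiltonian vector field `X^s_H`:
`qⁱ`-component `∂H/∂pᵢ`, `pᵢ`-component `−∂H/∂qⁱ`. -/
def Xs {n : ℕ} (H : Ms n → ℝ) : Ms n → Ms n :=
  fun x => (fun i => pd H (eP n i) x, fun i => - pd H (eQ n i) x)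

/-- Pairing of a one-form with components `(α_i, αⁱ)` with a vector field value. -/
def pairS {n : ℕ} (α v : Ms n) : ℝ := (∑ i, α.1 i * v.1 i) + ∑ i, α.2 i * v.2 i

/-- The Lie derivative of a one-form `α` (components `(α_i, αⁱ)`) along a vector
field `X`: `(L_X α)_j = Σ_k (X^k ∂α_j/∂x^k + α_k ∂X^k/∂x^j)`. -/
def lieD {n : ℕ} (X : Ms n → Ms n) (α : Ms n → Ms n) : Ms n → Ms n :=
  fun x =>
    (fun i => fderiv ℝ (fun y => (α y).1 i) x (X x)
        + fderiv ℝ (fun y => pairS (α x) (X y)) x (eQ n i),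
     fun i => fderiv ℝ (fun y => (α y).2 i) x (X x)
        + fderiv ℝ (fun y => pairS (α x) (X y)) x (eP n i))

/-- The plasma density associated to a one-form `Π`:
`f(Π) = Σᵢ (∂Πⁱ/∂qⁱ − ∂Π_i/∂pᵢ) = div ♯ˢ(Π)`. -/
def fdens {n : ℕ} (Pp : Ms n → Ms n) : Ms n → ℝ :=
  fun x => ∑ i, (fderiv ℝ (fun y => (Pp y).2 i) x (eQ n i)
      - fderiv ℝ (fun y => (Pp y).1 i) x (eP n i))

/-- Smooth real functions on phase space. -/
def Sm {n : ℕ} (F : Ms n → ℝ) : Prop := ContDiff ℝ (⊤ : ℕ∞) F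

theorem Sm.diff {n : ℕ} {F : Ms n → ℝ} (h : Sm F) (x : Ms n) : DifferentiableAt ℝ F x :=
  (ContDiff.differentiable h (by simp)) x

theorem smooth_dir {E : Type*} [NormedAddCommGroup E] [NormedSpace ℝ E] {F : E → ℝ}
    (h : ContDiff ℝ (⊤ : ℕ∞) F) (v : E) : ContDiff ℝ (⊤ : ℕ∞) (fun y => fderiv ℝ F y v) :=
  (h.fderiv_right (m := (⊤ : ℕ∞)) (by simp)).clm_apply contDiff_const

theorem dir_comm {E : Type*} [NormedAddCommGroup E] [NormedSpace ℝ E] {F : E → ℝ}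
    (h : ContDiff ℝ (⊤ : ℕ∞) F) (v w x : E) :
    fderiv ℝ (fun y => fderiv ℝ F y v) x w = fderiv ℝ (fun y => fderiv ℝ F y w) x v := by
  have h2 : DifferentiableAt ℝ (fderiv ℝ F) x :=
    ((h.fderiv_right (m := (⊤ : ℕ∞)) (by simp)).differentiable (by simp)) x
  have hs : IsSymmSndFDerivAt ℝ F x :=
    h.contDiffAt.isSymmSndFDerivAt (by simp; exact WithTop.coe_le_coe.2 (le_top : (2 : ℕ∞) ≤ ⊤))
  rw [fderiv_clm_apply h2 (differentiableAt_const _), fderiv_clm_apply h2 (differentiableAt_const _)]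
  simpa using hs.eq w v

theorem Sm.pd {n : ℕ} {F : Ms n → ℝ} (h : Sm F) (v : Ms n) : Sm (pd F v) := smooth_dir h v

theorem pd_comm {n : ℕ} {F : Ms n → ℝ} (h : Sm F) (v w x : Ms n) :
    pd (pd F v) w x = pd (pd F w) v x := dir_comm h v w x

theorem Sm.add {n : ℕ} {F G : Ms n → ℝ} (h : Sm F) (g : Sm G) : Sm (fun y => F y + G y) :=
  ContDiff.add h g
theorem Sm.sub {n : ℕ} {F G : Ms n → ℝ} (h : Sm F) (g : Sm G) : Sm (fun y => F y - G y) :=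
  ContDiff.sub h g
theorem Sm.mul {n : ℕ} {F G : Ms n → ℝ} (h : Sm F) (g : Sm G) : Sm (fun y => F y * G y) :=
  ContDiff.mul h g

theorem pd_add {n : ℕ} {F G : Ms n → ℝ} (h : Sm F) (g : Sm G) (v x : Ms n) :
    pd (fun y => F y + G y) v x = pd F v x + pd G v x := by
  simp [pd, fderiv_fun_add (h.diff x) (g.diff x)]
theorem pd_sub {n : ℕ} {F G : Ms n → ℝ} (h : Sm F) (g : Sm G) (v x : Ms n) :
    pd (fun y => F y - G y) v x = pd F v x - pd G v x := by
  simp [pd, fderiv_fun_sub (h.diff x) (g.diff x)]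
theorem pd_mul {n : ℕ} {F G : Ms n → ℝ} (h : Sm F) (g : Sm G) (v x : Ms n) :
    pd (fun y => F y * G y) v x = pd F v x * G x + F x * pd G v x := by
  simp [pd, fderiv_fun_mul (h.diff x) (g.diff x)]; ring
theorem pd_sum {n : ℕ} {F : Fin n → Ms n → ℝ} (h : ∀ k, Sm (F k)) (v x : Ms n) :
    pd (fun y => ∑ k, F k y) v x = ∑ k, pd (F k) v x := by
  simp [pd, fderiv_fun_sum (fun k _ => (h k).diff x)]

theorem Xs_eq {n : ℕ} (H : Ms n → ℝ) (x : Ms n) :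
    Xs H x = ∑ k, (pd H (eP n k) x • eQ n k - pd H (eQ n k) x • eP n k) := by
  ext j <;> simp [Xs, eQ, eP, Prod.fst_sum, Prod.snd_sum, Pi.single_apply]

theorem dir_Xs {n : ℕ} (H F : Ms n → ℝ) (x : Ms n) :
    fderiv ℝ F x (Xs H x)
      = ∑ k, (pd F (eQ n k) x * pd H (eP n k) x - pd F (eP n k) x * pd H (eQ n k) x) := by
  rw [Xs_eq]
  simp [pd, mul_comm]

theorem dir_pair {n : ℕ} {H : Ms n → ℝ} (hH : Sm H) (α x v : Ms n) :
    fderiv ℝ (fun y => pairS α (Xs H y)) x v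
      = ∑ k, (α.1 k * pd (pd H (eP n k)) v x - α.2 k * pd (pd H (eQ n k)) v x) := by
  have e : (fun y => pairS α (Xs H y))
      = fun y => ∑ k, (α.1 k * pd H (eP n k) y - α.2 k * pd H (eQ n k) y) := by
    funext y
    simp [pairS, Xs, sub_eq_add_neg, Finset.sum_add_distrib]
  have hc : ∀ c : ℝ, Sm (fun _ : Ms n => c) := fun c => contDiff_const
  have c0 : ∀ (c : ℝ), pd (fun _ : Ms n => c) v x = 0 := by intro c; simp [pd]
  change pd _ v x = _
  rw [e, pd_sum (fun k => ((hc _).mul (hH.pd _)).sub ((hc _).mul (hH.pd _)))]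
  refine Finset.sum_congr rfl fun k _ => ?_
  rw [pd_sub ((hc _).mul (hH.pd _)) ((hc _).mul (hH.pd _)), pd_mul (hc _) (hH.pd _),
    pd_mul (hc _) (hH.pd _), c0, c0]
  ring

/-- Derivative of one component of the Lie derivative. -/
theorem pd_comp {n : ℕ} {H : Ms n → ℝ} (hH : Sm H) {a b : Fin n → Ms n → ℝ}
    (ha : ∀ k, Sm (a k)) (hb : ∀ k, Sm (b k)) {F : Ms n → ℝ} (hF : Sm F) (v w x : Ms n) :
    pd (fun y => (∑ k, (pd F (eQ n k) y * pd H (eP n k) y - pd F (eP n k) y * pd H (eQ n k) y))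
        + ∑ k, (a k y * pd (pd H (eP n k)) v y - b k y * pd (pd H (eQ n k)) v y)) w x
    = ∑ k, (pd (pd F (eQ n k)) w x * pd H (eP n k) x + pd F (eQ n k) x * pd (pd H (eP n k)) w x
        - (pd (pd F (eP n k)) w x * pd H (eQ n k) x + pd F (eP n k) x * pd (pd H (eQ n k)) w x)
        + ((pd (a k) w x * pd (pd H (eP n k)) v x + a k x * pd (pd (pd H (eP n k)) v) w x)
        - (pd (b k) w x * pd (pd H (eQ n k)) v x + b k x * pd (pd (pd H (eQ n k)) v) w x))) := by
  have h1 : ∀ k, Sm (fun y => pd F (eQ n k) y * pd H (eP n k) y) :=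
    fun k => (hF.pd _).mul (hH.pd _)
  have h2 : ∀ k, Sm (fun y => pd F (eP n k) y * pd H (eQ n k) y) :=
    fun k => (hF.pd _).mul (hH.pd _)
  have h3 : ∀ k, Sm (fun y => a k y * pd (pd H (eP n k)) v y) :=
    fun k => (ha k).mul ((hH.pd _).pd _)
  have h4 : ∀ k, Sm (fun y => b k y * pd (pd H (eQ n k)) v y) :=
    fun k => (hb k).mul ((hH.pd _).pd _)
  simp only [← Finset.sum_add_distrib]
  rw [pd_sum (fun k => ((h1 k).sub (h2 k)).add ((h3 k).sub (h4 k)))]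
  refine Finset.sum_congr rfl fun k _ => ?_
  rw [pd_add ((h1 k).sub (h2 k)) ((h3 k).sub (h4 k)), pd_sub (h1 k) (h2 k), pd_sub (h3 k) (h4 k),
    pd_mul (hF.pd _) (hH.pd _), pd_mul (hF.pd _) (hH.pd _), pd_mul (ha k) ((hH.pd _).pd _),
    pd_mul (hb k) ((hH.pd _).pd _)]

theorem intertwine {n : ℕ} {H : Ms n → ℝ} (hH : Sm H) {Pp : Ms n → Ms n}
    (hPp : ContDiff ℝ (⊤ : ℕ∞) Pp) (x : Ms n) :
    fdens (lieD (Xs H) Pp) x = sBracket (fdens Pp) H x := by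
  obtain ⟨a, ha'⟩ : ∃ a : Fin n → Ms n → ℝ, a = fun k y => (Pp y).1 k := ⟨_, rfl⟩
  obtain ⟨b, hb'⟩ : ∃ b : Fin n → Ms n → ℝ, b = fun k y => (Pp y).2 k := ⟨_, rfl⟩
  have ha : ∀ k, Sm (a k) := by
    intro k; subst ha'; exact contDiff_pi.1 (contDiff_fst.comp hPp) k
  have hb : ∀ k, Sm (b k) := by
    intro k; subst hb'; exact contDiff_pi.1 (contDiff_snd.comp hPp) k
  have hf : fdens Pp = fun y => ∑ i, (pd (b i) (eQ n i) y - pd (a i) (eP n i) y) := by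
    subst ha' hb'; rfl
  have hL : fdens (lieD (Xs H) Pp) x = ∑ i,
      (pd (fun y => (∑ k, (pd (b i) (eQ n k) y * pd H (eP n k) y
            - pd (b i) (eP n k) y * pd H (eQ n k) y))
        + ∑ k, (a k y * pd (pd H (eP n k)) (eP n i) y
            - b k y * pd (pd H (eQ n k)) (eP n i) y)) (eQ n i) x
      - pd (fun y => (∑ k, (pd (a i) (eQ n k) y * pd H (eP n k) y
            - pd (a i) (eP n k) y * pd H (eQ n k) y))
        + ∑ k, (a k y * pd (pd H (eP n k)) (eQ n i) y
            - b k y * pd (pd H (eQ n k)) (eQ n i) y)) (eP n i) x) := by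
    subst ha' hb'
    simp only [fdens, lieD, dir_Xs, dir_pair hH]
    rfl
  have hR : sBracket (fdens Pp) H x = ∑ i, ∑ k,
      ((pd (pd (b i) (eQ n i)) (eQ n k) x - pd (pd (a i) (eP n i)) (eQ n k) x) * pd H (eP n k) x
      - (pd (pd (b i) (eQ n i)) (eP n k) x - pd (pd (a i) (eP n i)) (eP n k) x)
        * pd H (eQ n k) x) := by
    rw [hf, Finset.sum_comm]
    unfold sBracket
    refine Finset.sum_congr rfl fun k _ => ?_
    have hh : ∀ i, Sm (fun y => pd (b i) (eQ n i) y - pd (a i) (eP n i) y) :=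
      fun i => ((hb i).pd _).sub ((ha i).pd _)
    rw [pd_sum hh, pd_sum hh, Finset.sum_mul, Finset.sum_mul, ← Finset.sum_sub_distrib]
    refine Finset.sum_congr rfl fun i _ => ?_
    rw [pd_sub ((hb i).pd _) ((ha i).pd _), pd_sub ((hb i).pd _) ((ha i).pd _)]
  let G : Fin n → Fin n → ℝ := fun i k =>
    pd (b i) (eQ n k) x * pd (pd H (eP n k)) (eQ n i) x
    - pd (b i) (eP n k) x * pd (pd H (eQ n k)) (eQ n i) x
    - pd (a i) (eQ n k) x * pd (pd H (eP n k)) (eP n i) x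
    + pd (a i) (eP n k) x * pd (pd H (eQ n k)) (eP n i) x
  have hG : ∑ i, ∑ k, (G i k - G k i) = 0 := by
    simp only [Finset.sum_sub_distrib]
    rw [Finset.sum_comm, sub_self]
  rw [hL, hR, ← add_zero (∑ i, ∑ k, _), ← hG, ← Finset.sum_add_distrib]
  refine Finset.sum_congr rfl fun i _ => ?_
  rw [pd_comp hH ha hb (hb i), pd_comp hH ha hb (ha i), ← Finset.sum_add_distrib,
    ← Finset.sum_sub_distrib]
  refine Finset.sum_congr rfl fun k _ => ?_
  simp only [G]
  rw [pd_comm (hb i) (eQ n i) (eQ n k), pd_comm (hb i) (eQ n i) (eP n k),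
    pd_comm (ha i) (eP n i) (eQ n k), pd_comm (ha i) (eP n i) (eP n k),
    pd_comm (hH.pd (eP n k)) (eP n i) (eQ n i), pd_comm (hH.pd (eQ n k)) (eP n i) (eQ n i),
    pd_comm hH (eP n i) (eQ n k), pd_comm hH (eQ n i) (eQ n k), pd_comm hH (eP n i) (eP n k),
    pd_comm hH (eQ n i) (eP n k)]
  ring

/-- Exchange of the time derivative and a spatial directional derivative. -/
theorem time_comm {n : ℕ} {B : ℝ → Ms n → ℝ}
    (hB : ContDiff ℝ (⊤ : ℕ∞) (fun sx : ℝ × Ms n => B sx.1 sx.2)) (v x : Ms n) (s : ℝ) :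
    HasDerivAt (fun u => fderiv ℝ (B u) x v)
      (fderiv ℝ (fun y => deriv (fun u => B u y) s) x v) s := by
  set F : ℝ × Ms n → ℝ := fun sx => B sx.1 sx.2 with hF
  have hsp : ∀ {K : ℝ × Ms n → ℝ}, ContDiff ℝ (⊤ : ℕ∞) K → ∀ (u : ℝ) (y w : Ms n),
      fderiv ℝ (fun z => K (u, z)) y w = fderiv ℝ K (u, y) (0, w) := by
    intro K hK u y w
    have h := ((hK.differentiable (by simp)) (u, y)).hasFDerivAt.comp y
      (hasFDerivAt_prodMk_right u y)
    have h' := h.fderiv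
    simp only [Function.comp_def] at h'
    rw [h']; simp
  have htm : ∀ {K : ℝ × Ms n → ℝ}, ContDiff ℝ (⊤ : ℕ∞) K → ∀ (u : ℝ) (y : Ms n),
      HasDerivAt (fun r => K (r, y)) (fderiv ℝ K (u, y) (1, 0)) u := by
    intro K hK u y
    exact ((hK.differentiable (by simp)) (u, y)).hasFDerivAt.comp_hasDerivAt u
      ((hasDerivAt_id u).prodMk (hasDerivAt_const u y))
  have e1 : (fun u => fderiv ℝ (B u) x v) = fun u => fderiv ℝ F (u, x) (0, v) := by
    funext u; exact hsp hB u x v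
  have e2 : (fun y => deriv (fun u => B u y) s) = fun y => fderiv ℝ F (s, y) (1, 0) := by
    funext y; exact (htm hB s y).deriv
  rw [e1, e2, hsp (smooth_dir hB (1, 0)) s x v, dir_comm hB]
  exact htm (smooth_dir hB (0, v)) s x

/-- The density map intertwines the momentum-Vlasov and Vlasov flows:
`f(L_{X^s_H} Π) = {f(Π), H}^s`; consequently any solution of the momentum-Vlasov
equation `∂Π/∂s = −L_{X^s_H}Π` yields a solution `f(Π)` of the Vlasov equation
`∂f/∂s = {H, f}^s`. -/
theorem momentum_Vlasov_to_Vlasov (n : ℕ) (H : Ms n → ℝ) (hH : ContDiff ℝ (⊤ : ℕ∞) H)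
    (Pp : Ms n → Ms n) (hPp : ContDiff ℝ (⊤ : ℕ∞) Pp) :
    (∀ x, fdens (lieD (Xs H) Pp) x = sBracket (fdens Pp) H x)
  ∧ ∀ Ppt : ℝ → Ms n → Ms n,
      ContDiff ℝ (⊤ : ℕ∞) (fun sx : ℝ × Ms n => Ppt sx.1 sx.2) →
      (∀ s x, deriv (fun u => Ppt u x) s = - lieD (Xs H) (Ppt s) x) →
      (∀ s x, deriv (fun u => fdens (Ppt u) x) s = sBracket H (fdens (Ppt s)) x) := by
  refine ⟨fun x => intertwine hH hPp x, fun Ppt hP hev s x => ?_⟩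
  have hPs : ContDiff ℝ (⊤ : ℕ∞) (Ppt s) :=
    hP.comp (contDiff_const.prodMk contDiff_id : ContDiff ℝ (⊤ : ℕ∞) (fun y : Ms n => (s, y)))
  have h1 : ∀ i, ContDiff ℝ (⊤ : ℕ∞) (fun sx : ℝ × Ms n => (Ppt sx.1 sx.2).1 i) :=
    fun i => contDiff_pi.1 (contDiff_fst.comp hP) i
  have h2 : ∀ i, ContDiff ℝ (⊤ : ℕ∞) (fun sx : ℝ × Ms n => (Ppt sx.1 sx.2).2 i) :=
    fun i => contDiff_pi.1 (contDiff_snd.comp hP) i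
  have hd : ∀ y, HasDerivAt (fun u => Ppt u y) (- lieD (Xs H) (Ppt s) y) s := by
    intro y
    rw [← hev s y]
    have : ContDiff ℝ (⊤ : ℕ∞) (fun u => Ppt u y) :=
      hP.comp (contDiff_id.prodMk contDiff_const : ContDiff ℝ (⊤ : ℕ∞) (fun u : ℝ => (u, y)))
    exact ((this.differentiable (by simp)) s).hasDerivAt
  have e1 : ∀ i, (fun y => deriv (fun u => (Ppt u y).1 i) s)
      = fun y => -(lieD (Xs H) (Ppt s) y).1 i := by
    intro i; funext y
    exact (hasDerivAt_pi.1 (hd y).fst i).deriv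
  have e2 : ∀ i, (fun y => deriv (fun u => (Ppt u y).2 i) s)
      = fun y => -(lieD (Xs H) (Ppt s) y).2 i := by
    intro i; funext y
    exact (hasDerivAt_pi.1 (hd y).snd i).deriv
  have key := HasDerivAt.fun_sum (u := Finset.univ) (fun i _ =>
    (time_comm (B := fun u y => (Ppt u y).2 i) (h2 i) (eQ n i) x s).sub (time_comm (B := fun u y => (Ppt u y).1 i) (h1 i) (eP n i) x s))
  have key' := key.deriv
  have hfd : deriv (fun u => fdens (Ppt u) x) s = - fdens (lieD (Xs H) (Ppt s)) x := by
    refine Eq.trans key' ?_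
    simp only [e1, e2, fdens, fderiv_fun_neg]
    rw [← Finset.sum_neg_distrib]
    refine Finset.sum_congr rfl fun i _ => ?_
    simp only [neg_apply]
    ring
  rw [hfd, intertwine hH hPs]
  unfold sBracket
  rw [← Finset.sum_neg_distrib]
  refine Finset.sum_congr rfl fun i _ => ?_
  ring
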